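/- Let b be an extreme point of the closed unit ball of H^∞ (equivalently ∫_𝕋 log(1 − |b|) dm = −∞), let E = {ζ ∈ 𝕋 : |b(ζ)| < 1}, and let K = {(bh, √(1 − |b|²) h) : h ∈ H²} ⊂ H² ⊕ L²(E). Then the set of pairs (f, g) in the orthogonal complement K^⊥ (inside H² ⊕ L²(E)) for which the analytic extension of f to D extends continuously to the closed unit disc is dense in K^⊥. -/

import Mathlib

/-!
Statement 2: Let `b` be an extreme point of the closed unit ball of `H^∞`,
`E = {ζ ∈ 𝕋 : |b(ζ)| < 1}` and `K = {(b h, √(1-|b|²) h) : h ∈ H²} ⊂ H² ⊕ L²(E)`.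
Then the pairs `(f, g) ∈ K^⊥` (orthogonal complement inside `H² ⊕ L²(E)`)
whose first coordinate extends continuously to the closed unit disc are dense
in `K^⊥`.

The direct sum `H² ⊕ L²(E)` is flattened: a pair `(f, g)` with `f ∈ H²`,
`g ∈ L²` vanishing a.e. off `E`, carrying the norm
`‖(f,g)‖ = √(‖f‖² + ‖g‖²)`; orthogonality to `K` is written out as the
vanishing of the inner products against `(b h, √(1-|b|²) h)`, `h ∈ H²`.
-/

open MeasureTheory Complex Metric Filter Set
open scoped Real ENNReal Topology ComplexConjugate

noncomputable section

instance fact_two_pi : Fact (0 < 2 * Real.pi) := ⟨by positivity⟩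

abbrev CircT := AddCircle (2 * Real.pi)
abbrev m : Measure CircT := AddCircle.haarAddCircle
abbrev L2 := Lp ℂ 2 m

/-- The point `e^{iθ}` of the unit circle in `ℂ` corresponding to `θ`. -/
def pt (θ : CircT) : ℂ := (AddCircle.toCircle θ : ℂ)

/-- The Hardy space `H²`. -/
def H2 : Submodule ℂ L2 :=
  (Submodule.span ℂ (Set.range fun n : ℕ => fourierLp 2 (n : ℤ))).topologicalClosure

/-- `(f, g)` is a member of `K^⊥`, the orthogonal complement of
`K = {(b h, √(1-|b|²) h) : h ∈ H²}` inside `H² ⊕ L²(E)`: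
`f ∈ H²`, `g` vanishes a.e. off `E = {|b| < 1}`, and `(f,g) ⟂ K`. -/
def MemKperp (b : CircT → ℂ) (f g : L2) : Prop :=
  f ∈ H2 ∧ (∀ᵐ θ ∂m, ¬ ‖b θ‖ < 1 → g θ = 0) ∧
  ∀ h : L2, h ∈ H2 →
    (∫ θ, (starRingEnd ℂ) (b θ * h θ) * f θ ∂m)
      + (∫ θ, (starRingEnd ℂ) ((Real.sqrt (1 - ‖b θ‖^2) : ℂ) * h θ) * g θ ∂m) = 0

/-- `f` (an `L²` boundary function) belongs to the disc algebra `𝒜`: its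
analytic extension to the open disc extends continuously to the closed disc. -/
def InDiscAlgebra (f : L2) : Prop :=
  ∃ F : ℂ → ℂ, ContinuousOn F (closedBall (0:ℂ) 1) ∧
    DifferentiableOn ℂ F (ball (0:ℂ) 1) ∧ ∀ᵐ θ ∂m, f θ = F (pt θ)

/-- `-log x`, valued in `[0,∞]`, with value `∞` for `x ≤ 0`; used to express
`∫ log(1-|b|) dm = -∞` as `∫⁻ negLogNN (1-|b|) dm = ∞`. -/
def negLogNN (x : ℝ) : ℝ≥0∞ := if x ≤ 0 then ⊤ else ENNReal.ofReal (-Real.log x)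

lemma inner_eq (x y : L2) : inner ℂ x y = ∫ θ, (starRingEnd ℂ) (x θ) * y θ ∂m := by
  rw [L2.inner_def]
  refine integral_congr_ae (Eventually.of_forall fun θ => ?_)
  simp [RCLike.inner_apply, mul_comm]

lemma pt_norm (θ : CircT) : ‖pt θ‖ = 1 := Circle.norm_coe _

lemma pt_cont : Continuous pt := by
  unfold pt
  exact continuous_subtype_val.comp AddCircle.continuous_toCircle

lemma pt_mem (θ : CircT) : pt θ ∈ closedBall (0:ℂ) 1 := by simp [pt_norm]

lemma fourier_nat (n : ℕ) (θ : CircT) : fourier (n : ℤ) θ = pt θ ^ n := by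
  simp [fourier_apply, pt, AddCircle.toCircle_nsmul]

/-- multiplication by a bounded function -/
def mulL {a : CircT → ℂ} (ha : MemLp a ⊤ m) (x : L2) : L2 :=
  (MemLp.mul (p := ⊤) (q := 2) (r := 2) (Lp.memLp x) ha).toLp

lemma mulL_coe {a : CircT → ℂ} (ha : MemLp a ⊤ m) (x : L2) :
    ∀ᵐ θ ∂m, mulL ha x θ = a θ * x θ := by
  filter_upwards [MemLp.coeFn_toLp (MemLp.mul (p := ⊤) (q := 2) (r := 2) (Lp.memLp x) ha)] with θ h
  simpa [mulL] using h

lemma memConj {a : CircT → ℂ} (ha : MemLp a ⊤ m) : MemLp (fun θ => conj (a θ)) ⊤ m := ha.star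

lemma mulL_adj {a : CircT → ℂ} (ha : MemLp a ⊤ m) (x y : L2) :
    inner ℂ (mulL ha x) y = inner ℂ x (mulL (memConj ha) y) := by
  rw [inner_eq, inner_eq]
  refine integral_congr_ae ?_
  filter_upwards [mulL_coe ha x, mulL_coe (memConj ha) y] with θ h1 h2
  rw [h1, h2]; simp; ring

lemma mulL_norm {a : CircT → ℂ} (ha : MemLp a ⊤ m) (x : L2) (C : ℝ)
    (h : ∀ᵐ θ ∂m, ‖a θ‖ ≤ C) : ‖mulL ha x‖ ≤ C * ‖x‖ := by
  refine Lp.norm_le_mul_norm_of_ae_le_mul ?_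
  filter_upwards [mulL_coe ha x, h] with θ h1 h2
  rw [h1, norm_mul]
  gcongr

lemma cont_mem {a : CircT → ℂ} (ha : Continuous a) : MemLp a ⊤ m := by
  obtain ⟨C, hC⟩ := (isCompact_range ha).isBounded.exists_norm_le
  exact memLp_top_of_bound ha.aestronglyMeasurable C
    (Eventually.of_forall fun θ => hC _ ⟨θ, rfl⟩)


lemma mem_H2_iff (x : L2) : x ∈ H2 ↔ ∀ n : ℕ, inner ℂ (fourierLp 2 (-((n:ℤ)+1)) : L2) x = 0 := by
  constructor
  · intro hx n
    have hle : H2 ≤ (Submodule.span ℂ {(fourierLp 2 (-((n:ℤ)+1)) : L2)})ᗮ := by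
      refine Submodule.topologicalClosure_minimal _ ?_ (Submodule.isClosed_orthogonal _)
      rw [Submodule.span_le]
      rintro _ ⟨k, rfl⟩
      simp only [SetLike.mem_coe, Submodule.mem_orthogonal_singleton_iff_inner_right]
      exact orthonormal_fourier.2 (by omega)
    exact Submodule.mem_orthogonal_singleton_iff_inner_right.1 (hle hx)
  · intro h
    have hs := hasSum_fourier_series_L2 x
    refine Submodule.isClosed_topologicalClosure _ |>.mem_of_tendsto hs
      (Eventually.of_forall fun s => ?_)
    refine Submodule.sum_mem _ fun i _ => ?_
    rcases lt_or_ge i 0 with hi | hi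
    · have : fourierCoeff x i = 0 := by
        rw [← fourierBasis_repr, HilbertBasis.repr_apply_apply, coe_fourierBasis]
        obtain ⟨k, hk⟩ := Int.eq_ofNat_of_zero_le (show 0 ≤ -i - 1 by omega)
        have := h k
        rwa [show (-((k:ℤ)+1)) = i by omega] at this
      rw [this, zero_smul]; exact Submodule.zero_mem _
    · refine Submodule.smul_mem _ _ (Submodule.le_topologicalClosure _ (Submodule.subset_span ?_))
      exact ⟨i.toNat, by simp [Int.toNat_of_nonneg hi]⟩

lemma inner_fourier (n : ℤ) (x : L2) :
    inner ℂ (fourierLp 2 n : L2) x = ∫ θ, fourier (-n) θ * x θ ∂m := by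
  rw [inner_eq]
  refine integral_congr_ae ?_
  filter_upwards [coeFn_fourierLp (T := 2*π) 2 n] with θ h
  rw [h, fourier_neg]

/-- Orthogonality to all monomials extends to `H2`. -/
lemma H2_ortho (y : L2) (h : ∀ n : ℕ, inner ℂ (fourierLp 2 (n:ℤ) : L2) y = 0)
    (x : L2) (hx : x ∈ H2) : inner ℂ x y = 0 := by
  have hle : H2 ≤ (Submodule.span ℂ {y})ᗮ := by
    refine Submodule.topologicalClosure_minimal _ ?_ (Submodule.isClosed_orthogonal _)
    rw [Submodule.span_le]
    rintro _ ⟨k, rfl⟩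
    simp only [SetLike.mem_coe, Submodule.mem_orthogonal_singleton_iff_inner_left]
    exact h k
  exact Submodule.mem_orthogonal_singleton_iff_inner_left.1 (hle hx)

lemma mono_mem (n : ℕ) : (fourierLp 2 (n:ℤ) : L2) ∈ H2 :=
  Submodule.le_topologicalClosure _ (Submodule.subset_span ⟨n, rfl⟩)

/-- `z^n a ⟂ z^j`-type computation: bounded functions of class `H2` multiply `H2` into itself. -/
lemma mulL_mem {a : CircT → ℂ} (ha : MemLp a ⊤ m)
    (hH : ∀ n : ℕ, ∫ θ, pt θ ^ (n+1) * a θ ∂m = 0) (x : L2) (hx : x ∈ H2) : mulL ha x ∈ H2 := by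
  rw [mem_H2_iff]
  intro n
  rw [← inner_conj_symm, mulL_adj]
  rw [H2_ortho _ _ x hx, map_zero]
  intro k
  rw [inner_eq, ← map_zero (starRingEnd ℂ), ← hH (n + k), ← integral_conj]
  refine integral_congr_ae ?_
  filter_upwards [mulL_coe (memConj ha) (fourierLp 2 (-((n:ℤ)+1))),
    coeFn_fourierLp (T := 2*π) 2 (-((n:ℤ)+1)), coeFn_fourierLp (T := 2*π) 2 (k:ℤ)] with θ h1 h2 h3
  rw [h1, h2, h3, fourier_neg]
  rw [show ((n:ℤ)+1) = ((n+1:ℕ):ℤ) by simp, fourier_nat, fourier_nat]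
  simp
  ring

/-- Cauchy's formula on the circle. -/
lemma cauchy {F : ℂ → ℂ} (hc : ContinuousOn F (closedBall (0:ℂ) 1))
    (hd : DifferentiableOn ℂ F (ball (0:ℂ) 1)) {w : ℂ} (hw : w ∈ ball (0:ℂ) 1) :
    ∫ θ, (1 - w * conj (pt θ))⁻¹ * F (pt θ) ∂m = F w := by
  have key := two_pi_I_inv_smul_circleIntegral_sub_inv_smul_of_differentiable_on_off_countable
    (s := ∅) countable_empty hw hc
    (fun x hx => hd.differentiableAt (isOpen_ball.mem_nhds hx.1))
  rw [← key, AddCircle.integral_haarAddCircle, ← AddCircle.intervalIntegral_preimage (2*π) 0]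
  rw [circleIntegral, zero_add, ← intervalIntegral.integral_smul, ← intervalIntegral.integral_smul]
  refine intervalIntegral.integral_congr fun t _ => ?_
  have hp : pt (t : CircT) = circleMap 0 1 t := by
    simp [pt, AddCircle.toCircle_apply_mk, circleMap]
  have h1 : circleMap 0 1 t * conj (circleMap 0 1 t) = 1 := by
    rw [Complex.mul_conj, Complex.normSq_eq_norm_sq]; simp
  have h2 : circleMap 0 1 t - w ≠ 0 := by
    intro h
    have : ‖w‖ = 1 := by rw [← sub_eq_zero.1 h]; simp
    simp [this] at hw
  have h3 : (1 - w * conj (circleMap 0 1 t)) = conj (circleMap 0 1 t) * (circleMap 0 1 t - w) := by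
    linear_combination -h1
  have h4 : conj (circleMap 0 1 t) ≠ 0 := by
    intro h; rw [h] at h1; simp at h1
  have h5 : (conj (circleMap 0 1 t))⁻¹ = circleMap 0 1 t := by
    field_simp; linear_combination -h1
  simp only [hp, h3, deriv_circleMap, smul_eq_mul, real_smul, mul_inv, h5]
  have : (π:ℂ) ≠ 0 := by exact_mod_cast Real.pi_ne_zero
  push_cast
  field_simp

lemma disc_mean {F : ℂ → ℂ} (hc : ContinuousOn F (closedBall (0:ℂ) 1))
    (hd : DifferentiableOn ℂ F (ball (0:ℂ) 1)) : ∫ θ, F (pt θ) ∂m = F 0 := by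
  simpa using cauchy hc hd (w := 0) (by simp)

lemma disc_neg {F : ℂ → ℂ} (hc : ContinuousOn F (closedBall (0:ℂ) 1))
    (hd : DifferentiableOn ℂ F (ball (0:ℂ) 1)) (n : ℕ) :
    ∫ θ, pt θ ^ (n+1) * F (pt θ) ∂m = 0 := by
  have := disc_mean (F := fun z => z^(n+1) * F z) (by fun_prop) (by fun_prop)
  simpa using this

lemma disc_cont {F : ℂ → ℂ} (hc : ContinuousOn F (closedBall (0:ℂ) 1)) :
    Continuous (fun θ => F (pt θ)) :=
  hc.comp_continuous pt_cont pt_mem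


/-- Cauchy kernel. -/
def psi (w z : ℂ) : ℂ := (1 - conj w * z)⁻¹

lemma psi_re_pos {w z : ℂ} (hw : w ∈ ball (0:ℂ) 1) (hz : z ∈ closedBall (0:ℂ) 1) :
    0 < (1 - conj w * z).re := by
  have h1 : ‖w‖ < 1 := by simpa using hw
  have h2 : ‖z‖ ≤ 1 := by simpa using hz
  have h3 : (conj w * z).re ≤ ‖w‖ * ‖z‖ := by
    refine (re_le_norm _).trans ?_
    simp
  have : ‖w‖ * ‖z‖ ≤ ‖w‖ := mul_le_of_le_one_right (norm_nonneg _) h2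
  simp only [sub_re, one_re]
  linarith

lemma psi_ne {w z : ℂ} (hw : w ∈ ball (0:ℂ) 1) (hz : z ∈ closedBall (0:ℂ) 1) :
    1 - conj w * z ≠ 0 := by
  intro h
  have := psi_re_pos hw hz
  rw [h] at this
  simp at this

lemma psi_re {w z : ℂ} (hw : w ∈ ball (0:ℂ) 1) (hz : z ∈ closedBall (0:ℂ) 1) :
    0 ≤ (psi w z).re := by
  rw [psi, inv_re]
  exact div_nonneg (psi_re_pos hw hz).le (normSq_nonneg _)

lemma psi_cont {w : ℂ} (hw : w ∈ ball (0:ℂ) 1) : ContinuousOn (psi w) (closedBall (0:ℂ) 1) := by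
  unfold psi
  exact ContinuousOn.inv₀ (by fun_prop) fun z hz => psi_ne hw hz

lemma psi_diff {w : ℂ} (hw : w ∈ ball (0:ℂ) 1) : DifferentiableOn ℂ (psi w) (ball (0:ℂ) 1) := by
  unfold psi
  exact DifferentiableOn.inv (by fun_prop) fun z hz => psi_ne hw (ball_subset_closedBall hz)

lemma psiMem (w : ball (0:ℂ) 1) : MemLp (fun θ => psi w (pt θ)) ⊤ m :=
  cont_mem (disc_cont (psi_cont w.2))

def test (w : ball (0:ℂ) 1) (y : L2) : L2 := mulL (memConj (psiMem w)) y

def Good (δ : ℝ) (O : L2) : Prop :=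
  (∀ n : ℕ, inner ℂ O (fourierLp 2 (-((n:ℤ)+1)) : L2) = 0) ∧
  (∀ v : L2, ‖inner ℂ O v‖ ≤ ∫ θ, ‖v θ‖ ∂m) ∧
  1 - δ ≤ (inner ℂ O (fourierLp 2 0 : L2)).re

lemma integ1 (y : L2) : Integrable y m := (Lp.memLp y).integrable one_le_two

lemma integ {a : CircT → ℂ} (ha : MemLp a ⊤ m) (y : L2) : Integrable (fun θ => a θ * y θ) m :=
  memLp_one_iff_integrable.1 (MemLp.mul (p := ⊤) (q := 1) (r := 1)
    (memLp_one_iff_integrable.2 (integ1 y)) ha)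

lemma l1_le (y : L2) : ∫ θ, ‖y θ‖ ∂m ≤ ‖y‖ := by
  rw [integral_norm_eq_lintegral_enorm (integ1 y).1, ← eLpNorm_one_eq_lintegral_enorm, Lp.norm_def]
  exact ENNReal.toReal_mono (Lp.eLpNorm_ne_top y)
    (eLpNorm_le_eLpNorm_of_exponent_le one_le_two (integ1 y).1)

lemma prod_ge {ι : Type*} (s : Finset ι) (t : ι → ℝ) (ht : ∀ j ∈ s, 0 ≤ t j) :
    1 - ∑ j ∈ s, t j ≤ ∏ j ∈ s, (1 + t j)⁻¹ ∧ 0 ≤ ∏ j ∈ s, (1 + t j)⁻¹ ∧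
      ∏ j ∈ s, (1 + t j)⁻¹ ≤ 1 := by
  classical
  induction s using Finset.induction_on with
  | empty => simp
  | insert a s has ih =>
    obtain ⟨h1, h2, h3⟩ := ih fun j hj => ht j (Finset.mem_insert_of_mem hj)
    have h0 := ht a (Finset.mem_insert_self _ _)
    rw [Finset.prod_insert has, Finset.sum_insert has]
    have h4 : 0 < (1 + t a)⁻¹ := by positivity
    have h5 : (1 + t a)⁻¹ ≤ 1 := inv_le_one_of_one_le₀ (by linarith)
    have h6 : 1 - t a ≤ (1 + t a)⁻¹ := by
      rw [inv_eq_one_div, le_div_iff₀ (by linarith)]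
      nlinarith
    refine ⟨?_, by positivity, ?_⟩
    · nlinarith
    · nlinarith

lemma norm_one_add {F : ℂ} (hF : 0 ≤ F.re) : 1 ≤ ‖1 + F‖ ∧ ‖F‖ ≤ ‖1 + F‖ := by
  constructor
  · refine le_trans ?_ (re_le_norm _)
    simp [hF]
  · rw [← sq_le_sq₀ (norm_nonneg _) (norm_nonneg _), ← normSq_eq_norm_sq, ← normSq_eq_norm_sq,
      normSq_apply, normSq_apply]
    simp
    nlinarith

lemma build {ι : Type*} (y : ι → L2) (s : Finset ι) (W : Finset (ball (0:ℂ) 1))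
    (l : ι → ball (0:ℂ) 1 → ℝ) (hl : ∀ j w, 0 ≤ l j w) (hs : ∑ j ∈ s, ∑ w ∈ W, l j w = 1)
    (N : ℝ) (hN : 0 < N) :
    ∃ O : L2, Good (1/N) O ∧
      ∑ j ∈ s, ∑ w ∈ W, l j w * (inner ℂ O (test w (y j))).re ≤ N * ∑ j ∈ s, ‖y j‖ := by
  classical
  set F : ι → ℂ → ℂ := fun j z => ∑ w ∈ W, (l j w / N : ℂ) * psi w z with hF
  have hFre : ∀ j, ∀ z ∈ closedBall (0:ℂ) 1, 0 ≤ (F j z).re := by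
    intro j z hz
    simp only [hF, re_sum]
    refine Finset.sum_nonneg fun w _ => ?_
    rw [← ofReal_div, re_ofReal_mul]
    exact mul_nonneg (div_nonneg (hl _ _) hN.le) (psi_re w.2 hz)
  have hFc : ∀ j, ContinuousOn (F j) (closedBall (0:ℂ) 1) := fun j =>
    continuousOn_finsetSum _ fun w _ => continuousOn_const.mul (psi_cont w.2)
  have hFd : ∀ j, DifferentiableOn ℂ (F j) (ball (0:ℂ) 1) := fun j =>
    DifferentiableOn.fun_sum fun w _ => (psi_diff w.2).const_mul _
  have hne : ∀ j, ∀ z ∈ closedBall (0:ℂ) 1, 1 + F j z ≠ 0 := by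
    intro j z hz h
    have := (norm_one_add (hFre j z hz)).1
    rw [h] at this
    norm_num at this
  set G : ℂ → ℂ := fun z => ∏ j ∈ s, (1 + F j z)⁻¹ with hG
  have hGc : ContinuousOn G (closedBall (0:ℂ) 1) :=
    continuousOn_finsetProd _ fun j _ => ContinuousOn.inv₀ (continuousOn_const.add (hFc j)) (hne j)
  have hGd : DifferentiableOn ℂ G (ball (0:ℂ) 1) :=
    DifferentiableOn.fun_finsetProd fun j _ => DifferentiableOn.inv
      ((differentiableOn_const _).add (hFd j)) fun z hz => hne j z (ball_subset_closedBall hz)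
  have hGF : ∀ j ∈ s, ∀ z ∈ closedBall (0:ℂ) 1, ‖G z‖ * ‖F j z‖ ≤ 1 := by
    intro j hj z hz
    rw [hG]
    simp only
    rw [← Finset.mul_prod_erase _ _ hj, norm_mul, norm_prod]
    have h1 : ∏ i ∈ s.erase j, ‖(1 + F i z)⁻¹‖ ≤ 1 := by
      refine Finset.prod_le_one (fun _ _ => norm_nonneg _) fun i _ => ?_
      rw [norm_inv]
      exact inv_le_one_of_one_le₀ (norm_one_add (hFre i z hz)).1
    obtain ⟨h2, h3⟩ := norm_one_add (hFre j z hz)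
    have h4 : ‖(1 + F j z)⁻¹‖ * ‖F j z‖ ≤ 1 := by
      rw [norm_inv, inv_mul_le_iff₀ (by linarith)]
      linarith
    calc _ = (‖(1 + F j z)⁻¹‖ * ‖F j z‖) * ∏ i ∈ s.erase j, ‖(1 + F i z)⁻¹‖ := by ring
      _ ≤ 1 * 1 := by gcongr
      _ = 1 := by norm_num
  have hG1 : ∀ z ∈ closedBall (0:ℂ) 1, ‖G z‖ ≤ 1 := by
    intro z hz
    rw [hG]
    simp only
    rw [norm_prod]
    refine Finset.prod_le_one (fun _ _ => norm_nonneg _) fun i _ => ?_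
    rw [norm_inv]
    exact inv_le_one_of_one_le₀ (norm_one_add (hFre i z hz)).1
  have hcont := disc_cont hGc
  have hmem : MemLp (fun θ => G (pt θ)) 2 m := (cont_mem hcont).mono_exponent le_top
  have hin : ∀ v : L2, inner ℂ (hmem.toLp) v = ∫ θ, conj (G (pt θ)) * v θ ∂m := by
    intro v
    rw [inner_eq]
    refine integral_congr_ae ?_
    filter_upwards [hmem.coeFn_toLp] with θ h
    rw [h]
  refine ⟨hmem.toLp, ⟨?_, ?_, ?_⟩, ?_⟩
  · intro n
    rw [hin, ← map_zero (starRingEnd ℂ), ← disc_neg hGc hGd n, ← integral_conj]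
    refine integral_congr_ae ?_
    filter_upwards [coeFn_fourierLp (T := 2*π) 2 (-((n:ℤ)+1))] with θ h
    rw [h, fourier_neg, show ((n:ℤ)+1) = ((n+1:ℕ):ℤ) by simp, fourier_nat]
    simp
    ring
  · intro v
    rw [hin]
    refine (norm_integral_le_integral_norm _).trans (integral_mono_ae ?_ (integ1 v).norm ?_)
    · exact (integ (memConj (cont_mem hcont)) v).norm
    · refine Eventually.of_forall fun θ => ?_
      simp only [norm_mul, RCLike.norm_conj]
      exact mul_le_of_le_one_left (norm_nonneg _) (hG1 _ (pt_mem θ))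
  · have h0 : inner ℂ (hmem.toLp) (fourierLp 2 0 : L2) = conj (G 0) := by
      rw [hin, ← disc_mean hGc hGd, ← integral_conj]
      refine integral_congr_ae ?_
      filter_upwards [coeFn_fourierLp (T := 2*π) 2 0] with θ h
      rw [h]; simp
    rw [h0]
    have h1 : G 0 = ((∏ j ∈ s, (1 + ∑ w ∈ W, l j w / N)⁻¹ : ℝ) : ℂ) := by
      simp [hG, hF, psi]
    rw [h1, conj_ofReal, ofReal_re]
    have := (prod_ge s (fun j => ∑ w ∈ W, l j w / N) fun j _ =>
      Finset.sum_nonneg fun w _ => div_nonneg (hl _ _) hN.le).1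
    refine le_trans (le_of_eq ?_) this
    simp_rw [← Finset.sum_div]
    rw [hs]
  · rw [Finset.mul_sum]
    refine Finset.sum_le_sum fun j hj => ?_
    have h1 : ∑ w ∈ W, l j w * (inner ℂ hmem.toLp (test w (y j))).re
        = (∫ θ, N * (conj (G (pt θ)) * conj (F j (pt θ)) * y j θ) ∂m).re := by
      have : ∀ w ∈ W, l j w * (inner ℂ hmem.toLp (test w (y j))).re
        = (∫ θ, (l j w : ℂ) * (conj (G (pt θ)) * conj (psi w (pt θ)) * y j θ) ∂m).re := by
        intro w _
        rw [integral_const_mul, re_ofReal_mul, hin]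
        congr 2
        refine integral_congr_ae ?_
        filter_upwards [mulL_coe (memConj (psiMem w)) (y j)] with θ h
        rw [test, h]; ring
      rw [Finset.sum_congr rfl this, ← re_sum, ← integral_finsetSum]
      · congr 2
        ext θ
        have hN' : (N:ℂ) ≠ 0 := by exact_mod_cast hN.ne'
        simp only [hF, map_sum, map_mul, map_div₀, conj_ofReal, Finset.mul_sum, Finset.sum_mul]
        refine Finset.sum_congr rfl fun w _ => ?_
        field_simp
      · intro w _
        refine Integrable.const_mul ?_ _
        refine integ (a := fun θ => conj (G (pt θ)) * conj (psi w (pt θ))) (cont_mem ?_) _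
        exact (continuous_conj.comp hcont).mul (continuous_conj.comp (disc_cont (psi_cont w.2)))
    rw [h1, integral_const_mul, re_ofReal_mul]
    refine mul_le_mul_of_nonneg_left ?_ hN.le
    refine (re_le_norm _).trans ((norm_integral_le_integral_norm _).trans
      (le_trans (integral_mono_ae ?_ (integ1 (y j)).norm ?_) (l1_le _)))
    · refine (integ (a := fun θ => conj (G (pt θ)) * conj (F j (pt θ))) (cont_mem ?_) _).norm
      exact (continuous_conj.comp hcont).mul (continuous_conj.comp (disc_cont (hFc j)))
    · refine Eventually.of_forall fun θ => ?_
      simp only [norm_mul, RCLike.norm_conj]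
      exact mul_le_of_le_one_left (norm_nonneg _) (hGF j hj _ (pt_mem θ))

lemma good_convex (δ : ℝ) : Convex ℝ {O : L2 | Good δ O} := by
  intro x hx z hz a c ha hc hac
  obtain ⟨x1, x2, x3⟩ := hx
  obtain ⟨z1, z2, z3⟩ := hz
  have key : ∀ v : L2, inner ℂ (a • x + c • z) v = (a:ℂ) * inner ℂ x v + (c:ℂ) * inner ℂ z v := by
    intro v
    rw [inner_add_left, inner_smul_left_eq_smul, inner_smul_left_eq_smul, real_smul, real_smul]
  refine ⟨fun n => ?_, fun v => ?_, ?_⟩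
  · rw [key, x1, z1]; simp
  · rw [key]
    refine (norm_add_le _ _).trans ?_
    rw [norm_mul, norm_mul, norm_real, norm_real, Real.norm_of_nonneg ha, Real.norm_of_nonneg hc]
    calc _ ≤ a * (∫ θ, ‖v θ‖ ∂m) + c * (∫ θ, ‖v θ‖ ∂m) := by
            gcongr
            · exact x2 v
            · exact z2 v
      _ = _ := by rw [← add_mul, hac, one_mul]
  · rw [key, add_re, re_ofReal_mul, re_ofReal_mul]
    have : 1 - δ = a * (1 - δ) + c * (1 - δ) := by rw [← add_mul, hac, one_mul]
    rw [this]
    gcongr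

lemma sep {T : Type*} [Fintype T] (A : Set (T → ℝ)) (hAc : Convex ℝ A) (hone : A.Nonempty) (C' : ℝ)
    (h : ∀ x ∈ A, ∃ p, C' ≤ x p) :
    ∃ e : T → ℝ, ∃ u : ℝ, (∀ p, 0 ≤ e p) ∧ 0 < ∑ p, e p ∧ (∀ c < C', c * ∑ p, e p < u) ∧
      ∀ x ∈ A, u ≤ ∑ p, e p * x p := by
  classical
  let Bs : Set (T → ℝ) := Set.pi univ (fun _ => Iio C')
  have hBc : Convex ℝ Bs := convex_pi fun _ _ => convex_Iio _
  have hBo : IsOpen Bs := isOpen_set_pi finite_univ fun _ _ => isOpen_Iio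
  have hdis : Disjoint Bs A := by
    rw [Set.disjoint_left]
    intro x hb hx
    obtain ⟨p, hp⟩ := h x hx
    exact absurd (hb p (mem_univ _)) (not_lt.2 hp)
  obtain ⟨f, u, hfB, hfA⟩ := geometric_hahn_banach_open hBc hBo hAc hdis
  -- coefficients
  let e : T → ℝ := fun p => f (Pi.single p 1)
  have hfe : ∀ x, f x = ∑ p, e p * x p := by
    intro x
    conv_lhs => rw [← Finset.univ_sum_single x]
    rw [map_sum]
    refine Finset.sum_congr rfl fun p _ => ?_
    have : Pi.single p (x p) = x p • (Pi.single p 1 : T → ℝ) := by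
      rw [← Pi.single_smul]; simp
    rw [this, map_smul, smul_eq_mul, mul_comm]
  have hconst : ∀ c < C', c * ∑ p, e p < u := by
    intro c hc
    have := hfB (fun _ => c) (fun _ _ => hc)
    rwa [hfe, ← Finset.sum_mul, mul_comm] at this
  have he : ∀ p, 0 ≤ e p := by
    intro p
    by_contra! hneg
    set u0 := (C' - 1) * ∑ p, e p with hu0
    set t := max 0 ((u - u0) / (-e p)) with ht
    have hb := hfB (fun q => (C' - 1) - t * (Pi.single p (1:ℝ) : T → ℝ) q) (by
      intro q _
      have : 0 ≤ t * (Pi.single p (1:ℝ) : T → ℝ) q := by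
        refine mul_nonneg (le_max_left _ _) ?_
        by_cases hq : q = p
        · subst hq; simp
        · simp [hq]
      simp only [mem_Iio]; linarith)
    rw [hfe] at hb
    have h2 : ∑ q, e q * ((C' - 1) - t * (Pi.single p (1:ℝ) : T → ℝ) q) = u0 - t * e p := by
      have ha : ∑ q, e q * (t * (Pi.single p (1:ℝ) : T → ℝ) q) = t * e p := by
        rw [Finset.sum_eq_single p]
        · rw [Pi.single_eq_same, mul_one, mul_comm]
        · intro q _ hq; simp [hq]
        · simp
      rw [hu0, ← ha, mul_comm, Finset.sum_mul, ← Finset.sum_sub_distrib]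
      exact Finset.sum_congr rfl fun q _ => by ring
    rw [h2] at hb
    have h3 : (u - u0) / (-e p) ≤ t := le_max_right _ _
    rw [div_le_iff₀ (by linarith)] at h3
    linarith
  have hpos : 0 < ∑ p, e p := by
    refine (Finset.sum_nonneg fun p _ => he p).lt_of_ne ?_
    intro h0
    have h1 := hconst (C' - 1) (by linarith)
    rw [← h0, mul_zero] at h1
    obtain ⟨x, hx⟩ := hone
    have h2 := hfA _ hx
    rw [hfe] at h2
    have h3 : ∀ p, e p = 0 := by
      intro p
      exact (Finset.sum_eq_zero_iff_of_nonneg fun p _ => he p).1 h0.symm p (Finset.mem_univ _)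
    simp only [h3, zero_mul, Finset.sum_const_zero] at h2
    linarith
  exact ⟨e, u, he, hpos, hconst, fun x hx => by rw [← hfe]; exact hfA x hx⟩

lemma finite_step {ι : Type*} (y : ι → L2) (C C' N : ℝ) (hN : 0 < N)
    (hC : ∀ s : Finset ι, ∑ j ∈ s, ‖y j‖ ≤ C) (hC' : N * C < C')
    (s : Finset ι) (W : Finset (ball (0:ℂ) 1)) :
    ∃ O : L2, Good (1/N) O ∧ ∀ j ∈ s, ∀ w ∈ W, (inner ℂ O (test w (y j))).re ≤ C' := by
  classical
  by_contra! hcon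
  let T := {p : ι × ball (0:ℂ) 1 // p ∈ s ×ˢ W}
  let L : L2 → (T → ℝ) := fun O p => (inner ℂ O (test p.1.2 (y p.1.1))).re
  have hLlin : IsLinearMap ℝ L := by
    constructor
    · intro x z; ext p; simp [L, inner_add_left]
    · intro a x; ext p
      simp only [L, Pi.smul_apply, smul_eq_mul]
      rw [inner_smul_left_eq_smul, real_smul, re_ofReal_mul]
  let A : Set (T → ℝ) := L '' {O | Good (1/N) O}
  have hAc : Convex ℝ A := (good_convex _).is_linear_image hLlin
  have hone : ∃ O, Good (1/N) O := by
    obtain ⟨O, hO, -⟩ := build (fun _ : Unit => (0 : L2)) {()} {⟨0, by simp⟩} (fun _ _ => 1)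
      (fun _ _ => zero_le_one) (by simp) N hN
    exact ⟨O, hO⟩
  obtain ⟨O0, hO0⟩ := hone
  obtain ⟨e, u, he, hpos, hconst, hfA⟩ := sep A hAc ⟨L O0, O0, hO0, rfl⟩ C' (by
    rintro _ ⟨O, hO, rfl⟩
    obtain ⟨j, hj, w, hw, h⟩ := hcon O hO
    exact ⟨⟨(j, w), Finset.mem_product.2 ⟨hj, hw⟩⟩, h.le⟩)
  set M := ∑ p, e p with hM
  let l : ι → ball (0:ℂ) 1 → ℝ := fun j w =>
    if h : (j, w) ∈ s ×ˢ W then e ⟨(j, w), h⟩ / M else 0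
  have hsum : ∀ X : ι → ball (0:ℂ) 1 → ℝ,
      ∑ j ∈ s, ∑ w ∈ W, l j w * X j w = (∑ p, e p * X p.1.1 p.1.2) / M := by
    intro X
    rw [← Finset.sum_product' s W (fun j w => l j w * X j w),
      ← Finset.sum_coe_sort (s ×ˢ W), Finset.sum_div]
    refine Finset.sum_congr rfl fun p _ => ?_
    have : l p.1.1 p.1.2 = e p / M := by
      simp only [l]
      rw [dif_pos p.2]
    rw [this]; ring
  obtain ⟨O, hO, hle⟩ := build y s W l (by
      intro j w
      simp only [l]
      split_ifs
      · exact div_nonneg (he _) hpos.le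
      · exact le_rfl) (by
      have := hsum (fun _ _ => 1)
      simp only [mul_one] at this
      rw [this, ← hM, div_self hpos.ne']) N hN
  rw [hsum (fun j w => (inner ℂ O (test w (y j))).re), div_le_iff₀ hpos] at hle
  have h1 := hfA _ ⟨O, hO, rfl⟩
  have h2 : N * ∑ j ∈ s, ‖y j‖ ≤ N * C := mul_le_mul_of_nonneg_left (hC s) hN.le
  have h3 := hconst ((N * C + C') / 2) (by linarith)
  have h4 : N * (∑ j ∈ s, ‖y j‖) * M ≤ (N * C + C') / 2 * M :=
    mul_le_mul_of_nonneg_right (by linarith) hpos.le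
  have h5 : u ≤ N * (∑ j ∈ s, ‖y j‖) * M := h1.trans hle
  linarith

lemma key {ι : Type*} (y : ι → L2) (C C' N : ℝ) (hN : 0 < N)
    (hC : ∀ s : Finset ι, ∑ j ∈ s, ‖y j‖ ≤ C) (hC' : N * C < C') :
    ∃ O : L2, Good (1/N) O ∧ ∀ j w, (inner ℂ O (test w (y j))).re ≤ C' := by
  classical
  let D : L2 → WeakDual ℂ L2 := fun O => StrongDual.toWeakDual (InnerProductSpace.toDual ℂ L2 O)
  have hD : ∀ O v, D O v = inner ℂ O v := fun O v => rfl
  let S : Set (WeakDual ℂ L2) := (WeakDual.toStrongDual ⁻¹' closedBall 0 1) ∩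
    ({φ | ∀ n : ℕ, φ (fourierLp 2 (-((n:ℤ)+1)) : L2) = 0} ∩
     ({φ | ∀ v : L2, ‖φ v‖ ≤ ∫ θ, ‖v θ‖ ∂m} ∩
      {φ | 1 - 1/N ≤ (φ (fourierLp 2 0 : L2)).re}))
  have hev : ∀ v : L2, Continuous fun φ : WeakDual ℂ L2 => φ v := fun v =>
    WeakDual.eval_continuous v
  have hS : IsCompact S := by
    refine (WeakDual.isCompact_closedBall 0 1).inter_right (IsClosed.inter ?_ (IsClosed.inter ?_ ?_))
    · rw [ofPred_forall]
      exact isClosed_iInter fun n => isClosed_eq (hev _) continuous_const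
    · rw [ofPred_forall]
      exact isClosed_iInter fun v => isClosed_le (hev _).norm continuous_const
    · exact isClosed_le continuous_const (continuous_re.comp (hev _))
  have hGS : ∀ O, Good (1/N) O → D O ∈ S := by
    rintro O ⟨h1, h2, h3⟩
    refine ⟨?_, h1, h2, h3⟩
    simp only [mem_preimage, mem_closedBall, dist_zero_right]
    refine ContinuousLinearMap.opNorm_le_bound _ zero_le_one fun v => ?_
    rw [one_mul]
    exact (h2 v).trans (l1_le v)
  have := hS.inter_iInter_nonempty
    (fun p : ι × ball (0:ℂ) 1 => {φ : WeakDual ℂ L2 | (φ (test p.2 (y p.1))).re ≤ C'})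
    (fun p => isClosed_le (continuous_re.comp (hev _)) continuous_const) (by
      intro U
      obtain ⟨O, hO, h⟩ := finite_step y C C' N hN hC hC' (U.image Prod.fst) (U.image Prod.snd)
      refine ⟨D O, hGS O hO, ?_⟩
      simp only [mem_iInter, mem_ofPred_eq]
      intro p hp
      exact h _ (Finset.mem_image_of_mem _ hp) _ (Finset.mem_image_of_mem _ hp))
  obtain ⟨φ, ⟨-, h1, h2, h3⟩, h4⟩ := this
  let O : L2 := (InnerProductSpace.toDual ℂ L2).symm (WeakDual.toStrongDual φ)
  have hO : ∀ v, inner ℂ O v = φ v := fun v => InnerProductSpace.toDual_symm_apply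
  refine ⟨O, ⟨?_, ?_, ?_⟩, ?_⟩
  · intro n; rw [hO]; exact h1 n
  · intro v; rw [hO]; exact h2 v
  · rw [hO]; exact h3
  · intro j w
    rw [hO]
    exact mem_iInter.1 h4 (j, w)

lemma good_ae {O : L2} (h : ∀ v : L2, ‖inner ℂ O v‖ ≤ ∫ θ, ‖v θ‖ ∂m) : ∀ᵐ θ ∂m, ‖O θ‖ ≤ 1 := by
  classical
  have hOm : Measurable (O : CircT → ℂ) := (Lp.stronglyMeasurable O).measurable
  set S : Set CircT := {θ | 1 < ‖O θ‖} with hS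
  have hSm : MeasurableSet S := measurableSet_lt measurable_const hOm.norm
  set v : CircT → ℂ := S.indicator (fun θ => O θ / ‖O θ‖) with hv
  have hvm : Measurable v :=
    (hOm.div (Complex.measurable_ofReal.comp hOm.norm)).indicator hSm
  have hvn : ∀ θ, ‖v θ‖ = S.indicator 1 θ := by
    intro θ
    by_cases hθ : θ ∈ S
    · have : 1 < ‖O θ‖ := hθ
      simp only [hv, indicator_of_mem hθ, Pi.one_apply, norm_div, norm_real, norm_norm]
      rw [div_self (by linarith)]
    · simp [hv, indicator_of_notMem hθ]
  have hvmem : MemLp v 2 m := MemLp.of_bound hvm.aestronglyMeasurable 1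
    (Eventually.of_forall fun θ => by
      rw [hvn]; exact indicator_le_self' (by simp) _ |>.trans (by simp))
  have h1 := h hvmem.toLp
  have e1 : ∫ θ, ‖hvmem.toLp v θ‖ ∂m = ∫ θ, S.indicator (1 : CircT → ℝ) θ ∂m := by
    refine integral_congr_ae ?_
    filter_upwards [hvmem.coeFn_toLp] with θ hθ
    rw [hθ, hvn]
  have e2 : inner ℂ O (hvmem.toLp v) = ((∫ θ, S.indicator (fun θ => ‖O θ‖) θ ∂m : ℝ) : ℂ) := by
    rw [inner_eq, ← integral_complex_ofReal]
    refine integral_congr_ae ?_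
    filter_upwards [hvmem.coeFn_toLp] with θ hθ
    rw [hθ]
    by_cases hθ : θ ∈ S
    · have : 1 < ‖O θ‖ := hθ
      have h0 : (‖O θ‖ : ℂ) ≠ 0 := by
        have : ‖O θ‖ ≠ 0 := by linarith
        exact_mod_cast this
      simp only [hv, indicator_of_mem hθ]
      rw [← mul_div_assoc, mul_comm, mul_conj, normSq_eq_norm_sq]
      push_cast
      field_simp
    · simp [hv, indicator_of_notMem hθ]
  have i1 : Integrable (S.indicator (1 : CircT → ℝ)) m := (integrable_const (1:ℝ)).indicator hSm
  have i2 : Integrable (S.indicator (fun θ => ‖O θ‖)) m := (integ1 O).norm.indicator hSm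
  rw [e1, e2, norm_real] at h1
  have h2 := (le_abs_self _).trans h1
  have h3 : ∫ θ, (S.indicator (fun θ => ‖O θ‖) θ - S.indicator (1 : CircT → ℝ) θ) ∂m ≤ 0 := by
    rw [integral_sub i2 i1]; linarith
  have hnn : ∀ θ, 0 ≤ S.indicator (fun θ => ‖O θ‖) θ - S.indicator (1 : CircT → ℝ) θ := by
    intro θ
    by_cases hθ : θ ∈ S
    · have : 1 < ‖O θ‖ := hθ
      simp only [indicator_of_mem hθ, Pi.one_apply]; linarith
    · simp [indicator_of_notMem hθ]
  have h4 := (integral_eq_zero_iff_of_nonneg hnn (i2.sub i1)).1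
    (le_antisymm h3 (integral_nonneg hnn))
  filter_upwards [h4] with θ hθ
  by_contra! hc
  have hm : θ ∈ S := hc
  simp only [indicator_of_mem hm, Pi.one_apply, Pi.zero_apply] at hθ
  linarith

lemma good_mem {δ : ℝ} {O : L2} (h : Good δ O) : MemLp (O : CircT → ℂ) ⊤ m :=
  memLp_top_of_bound (Lp.memLp O).1 1 (good_ae h.2.1)

lemma good_neg {δ : ℝ} {O : L2} (h : Good δ O) (n : ℕ) : ∫ θ, pt θ ^ (n+1) * O θ ∂m = 0 := by
  have := h.1 n
  rw [← inner_conj_symm, inner_fourier, neg_neg, map_eq_zero] at this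
  rw [← this]
  refine integral_congr_ae (Eventually.of_forall fun θ => ?_)
  simp only
  rw [show ((n:ℤ)+1) = ((n+1:ℕ):ℤ) by simp, fourier_nat]

lemma good_norm {δ : ℝ} {O : L2} (h : Good δ O) : ‖O‖ ≤ 1 := by
  have h1 := (h.2.1 O).trans (l1_le O)
  rw [inner_self_eq_norm_sq_to_K] at h1
  simp at h1
  by_contra! hc
  nlinarith

lemma good_close {δ : ℝ} {O : L2} (h : Good δ O) : ‖(fourierLp 2 0 : L2) - O‖^2 ≤ 2 * δ := by
  rw [norm_sub_sq (𝕜 := ℂ)]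
  have h1 : ‖(fourierLp 2 0 : L2)‖ = 1 := orthonormal_fourier.1 0
  have h2 := good_norm h
  have h3 := h.2.2
  rw [h1, inner_re_symm]
  have : ‖O‖^2 ≤ 1 := by have := norm_nonneg O; nlinarith
  simp only [RCLike.re_to_complex]
  linarith

lemma close (x : L2) (ε : ℝ) (hε : 0 < ε) : ∃ δ0 > 0, ∀ δ ≤ δ0, ∀ O : L2, ∀ h : Good δ O,
    ‖x - mulL (memConj (good_mem h)) x‖ < ε := by
  obtain ⟨c, hc⟩ := (ContinuousMap.toLp_denseRange ℂ m ℂ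
    (p := 2) (by simp)).exists_dist_lt x (ε := ε/4) (by linarith)
  set cl : L2 := ContinuousMap.toLp 2 m ℂ c with hcl
  set K := ‖c‖ + 1 with hK
  have hKpos : 0 < K := by positivity
  refine ⟨(ε / (4*K))^2 / 2, by positivity, fun δ hδ O h => ?_⟩
  have hO1 : ‖(fourierLp 2 0 : L2) - O‖ ≤ ε / (4*K) := by
    have := good_close h
    refine le_of_sq_le_sq ?_ (by positivity)
    linarith
  have ha : MemLp (fun θ => 1 - conj (O θ)) ⊤ m :=
    (cont_mem continuous_const).sub (memConj (good_mem h))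
  have hdec : x - mulL (memConj (good_mem h)) x = mulL ha (x - cl) + mulL ha cl := by
    refine Lp.ext ?_
    filter_upwards [mulL_coe (memConj (good_mem h)) x, mulL_coe ha (x - cl), mulL_coe ha cl,
      Lp.coeFn_sub x (mulL (memConj (good_mem h)) x), Lp.coeFn_sub x cl,
      Lp.coeFn_add (mulL ha (x - cl)) (mulL ha cl)] with θ h1 h2 h3 h4 h5 h6
    rw [h4, h6, Pi.sub_apply, Pi.add_apply, h1, h2, h3, h5, Pi.sub_apply]
    ring
  have b1 : ‖mulL ha (x - cl)‖ ≤ 2 * ‖x - cl‖ := by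
    refine mulL_norm _ _ _ ?_
    filter_upwards [good_ae h.2.1] with θ hθ
    refine (norm_sub_le _ _).trans ?_
    rw [RCLike.norm_conj, norm_one]; linarith
  have b2 : ‖mulL ha cl‖ ≤ K * ‖(fourierLp 2 0 : L2) - O‖ := by
    refine Lp.norm_le_mul_norm_of_ae_le_mul ?_
    filter_upwards [mulL_coe ha cl, Lp.coeFn_sub (fourierLp 2 0 : L2) O,
      coeFn_fourierLp (T := 2*π) 2 0, ContinuousMap.coeFn_toLp (p := 2) (𝕜 := ℂ) m c]
      with θ h1 h2 h3 h4
    rw [h1, h2, Pi.sub_apply, h3, hcl, h4, norm_mul, fourier_zero, mul_comm]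
    have : ‖(1:ℂ) - conj (O θ)‖ = ‖1 - O θ‖ := by
      rw [← RCLike.norm_conj]; simp
    rw [this]
    gcongr
    have := c.norm_coe_le_norm θ
    linarith
  have b3 : K * ‖(fourierLp 2 0 : L2) - O‖ ≤ ε / 4 := by
    calc _ ≤ K * (ε / (4*K)) := by gcongr
      _ = _ := by field_simp
  rw [dist_eq_norm] at hc
  rw [hdec]
  have := norm_add_le (mulL ha (x - cl)) (mulL ha cl)
  linarith

lemma poly_step {a : CircT → ℂ} (ha : MemLp a ⊤ m)
    (hH : ∀ n : ℕ, ∫ θ, pt θ ^ (n+1) * a θ ∂m = 0) (d : L2)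
    (hd : d ∈ Submodule.span ℂ (Set.range fun n : ℕ => (fourierLp 2 (n : ℤ) : L2))) :
    ∃ R : ℂ → ℂ, Differentiable ℂ R ∧ ∃ RL : L2, (∀ᵐ θ ∂m, RL θ = R (pt θ)) ∧
      ∀ h ∈ H2, inner ℂ h RL = inner ℂ (mulL ha h) d := by
  induction hd using Submodule.span_induction with
  | mem x hx =>
    obtain ⟨n, rfl⟩ := hx
    simp only
    set c : ℕ → ℂ := fun i => inner ℂ (mulL ha (fourierLp 2 (i:ℤ))) (fourierLp 2 (n:ℤ) : L2) with hc
    set Rc : C(CircT, ℂ) := ∑ i ∈ Finset.range (n+1), c i • fourier (i:ℤ) with hRc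
    refine ⟨fun w => ∑ i ∈ Finset.range (n+1), c i * w ^ i, by fun_prop,
      ContinuousMap.toLp 2 m ℂ Rc, ?_, ?_⟩
    · filter_upwards [ContinuousMap.coeFn_toLp (p := 2) (𝕜 := ℂ) m Rc] with θ h1
      rw [h1, hRc]
      simp [ContinuousMap.sum_apply, fourier_nat, -fourier_apply]
    · intro h hh
      rw [mulL_adj, ← sub_eq_zero, ← inner_sub_right]
      refine H2_ortho _ (fun k => ?_) h hh
      rw [inner_sub_right, ← mulL_adj, hRc, map_sum, inner_sum, sub_eq_zero]
      have : ∀ i ∈ Finset.range (n+1), inner ℂ (fourierLp 2 (k:ℤ) : L2)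
          (ContinuousMap.toLp 2 m ℂ (c i • fourier (i:ℤ))) = if k = i then c i else 0 := by
        intro i _
        rw [map_smul, inner_smul_right]
        have := orthonormal_iff_ite.1 (orthonormal_fourier (T := 2*π)) (k:ℤ) (i:ℤ)
        rw [this]
        simp
      rw [Finset.sum_congr rfl this, Finset.sum_ite_eq]
      split_ifs with hk
      · rfl
      · have hk' : n < k := by simpa using hk
        obtain ⟨j, rfl⟩ := Nat.exists_eq_add_of_lt hk'
        rw [inner_eq, ← map_zero (starRingEnd ℂ), ← hH j, ← integral_conj]
        refine (integral_congr_ae ?_).symm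
        filter_upwards [mulL_coe ha (fourierLp 2 ((n+j+1:ℕ):ℤ)),
          coeFn_fourierLp (T := 2*π) 2 ((n+j+1:ℕ):ℤ), coeFn_fourierLp (T := 2*π) 2 (n:ℤ)]
          with θ h1 h2 h3
        rw [h1, h2, h3, fourier_nat, fourier_nat]
        have : conj (pt θ) * pt θ = 1 := by
          rw [mul_comm, mul_conj, normSq_eq_norm_sq, pt_norm]; simp
        have h4 : conj (pt θ) ^ n * pt θ ^ n = 1 := by rw [← mul_pow, this, one_pow]
        simp only [map_mul, map_pow]
        linear_combination (conj (a θ) * conj (pt θ) ^ (j+1)) * h4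
  | zero =>
    refine ⟨0, differentiable_const _, 0, ?_, by simp⟩
    filter_upwards [Lp.coeFn_zero ℂ 2 m] with θ h
    rw [h]; rfl
  | add x z _ _ hx hz =>
    obtain ⟨R, h1, RL, h2, h3⟩ := hx
    obtain ⟨R', h1', RL', h2', h3'⟩ := hz
    refine ⟨R + R', h1.add h1', RL + RL', ?_, ?_⟩
    · filter_upwards [h2, h2', Lp.coeFn_add RL RL'] with θ a b c
      rw [c, Pi.add_apply, a, b]; rfl
    · intro h hh
      rw [inner_add_right, inner_add_right, h3 h hh, h3' h hh]
  | smul r x _ hx =>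
    obtain ⟨R, h1, RL, h2, h3⟩ := hx
    refine ⟨r • R, h1.const_smul r, r • RL, ?_, ?_⟩
    · filter_upwards [h2, Lp.coeFn_smul r RL] with θ a c
      rw [c, Pi.smul_apply, a]; rfl
    · intro h hh
      rw [inner_smul_right, inner_smul_right, h3 h hh]

lemma disc_mem {F : ℂ → ℂ} (hc : ContinuousOn F (closedBall (0:ℂ) 1))
    (hd : DifferentiableOn ℂ F (ball (0:ℂ) 1)) (x : L2) (hx : ∀ᵐ θ ∂m, x θ = F (pt θ)) :
    x ∈ H2 := by
  rw [mem_H2_iff]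
  intro n
  rw [inner_fourier, ← disc_neg hc hd n]
  refine integral_congr_ae ?_
  filter_upwards [hx] with θ h
  rw [h, neg_neg, show ((n:ℤ)+1) = ((n+1:ℕ):ℤ) by simp, fourier_nat]

lemma R_eval {δ : ℝ} {O : L2} (hO : Good δ O) {d RL : L2} {R : ℂ → ℂ} (hR : Differentiable ℂ R)
    (h1 : ∀ᵐ θ ∂m, RL θ = R (pt θ))
    (h2 : ∀ h ∈ H2, inner ℂ h RL = inner ℂ (mulL (good_mem hO) h) d) (w : ball (0:ℂ) 1) :
    R w = inner ℂ O (test w d) := by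
  have hm : MemLp (fun θ => psi w (pt θ)) 2 m := (psiMem w).mono_exponent le_top
  have e := h2 hm.toLp (disc_mem (psi_cont w.2) (psi_diff w.2) _ hm.coeFn_toLp)
  rw [← cauchy hR.continuous.continuousOn hR.differentiableOn w.2]
  trans inner ℂ hm.toLp RL
  · rw [inner_eq]
    refine integral_congr_ae ?_
    filter_upwards [h1, hm.coeFn_toLp] with θ a c
    rw [a, c]
    simp [psi]
  · rw [e, inner_eq, inner_eq]
    refine integral_congr_ae ?_
    filter_upwards [mulL_coe (good_mem hO) hm.toLp, hm.coeFn_toLp,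
      mulL_coe (memConj (psiMem w)) d] with θ a b c
    rw [a, b, test, c]
    simp; ring

lemma decomp (f : L2) (hf : f ∈ H2) : ∃ d : ℕ → L2,
    (∀ k, d k ∈ Submodule.span ℂ (Set.range fun n : ℕ => (fourierLp 2 (n : ℤ) : L2))) ∧
    HasSum d f ∧ Summable (fun k => 2^k * ‖d k‖) := by
  have hcl : f ∈ closure ((Submodule.span ℂ
      (Set.range fun n : ℕ => (fourierLp 2 (n : ℤ) : L2)) : Submodule ℂ L2) : Set L2) := hf
  have hex : ∀ k : ℕ, ∃ p ∈ Submodule.span ℂ (Set.range fun n : ℕ => (fourierLp 2 (n : ℤ) : L2)),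
      dist f p < (1/4:ℝ)^k := fun k => Metric.mem_closure_iff.1 hcl _ (by positivity)
  choose p hp hd using hex
  let d : ℕ → L2 := fun k => Nat.casesOn k (p 0) (fun j => p (j+1) - p j)
  have hd0 : d 0 = p 0 := rfl
  have hds : ∀ j, d (j+1) = p (j+1) - p j := fun j => rfl
  have hmem : ∀ k, d k ∈ Submodule.span ℂ (Set.range fun n : ℕ => (fourierLp 2 (n : ℤ) : L2)) := by
    intro k
    cases k with
    | zero => exact hp 0
    | succ j => exact Submodule.sub_mem _ (hp _) (hp _)
  have hsucc : ∀ j, ‖d (j+1)‖ ≤ 2 * (1/4:ℝ)^j := by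
    intro j
    rw [hds, ← dist_eq_norm]
    have h1 := dist_triangle_left (p (j+1)) (p j) f
    have h2 := hd j
    have h3 := hd (j+1)
    have h4 : (1/4:ℝ)^(j+1) ≤ (1/4:ℝ)^j := pow_le_pow_of_le_one (by norm_num) (by norm_num) (by omega)
    linarith
  have hsum2 : Summable (fun k => 2^k * ‖d k‖) := by
    rw [← summable_nat_add_iff 1]
    refine Summable.of_nonneg_of_le (fun k => by positivity) (fun k => ?_)
      ((summable_geometric_of_lt_one (r := (1/2:ℝ)) (by norm_num) (by norm_num)).mul_left 4)
    calc (2:ℝ)^(k+1) * ‖d (k+1)‖ ≤ 2^(k+1) * (2 * (1/4:ℝ)^k) := by gcongr; exact hsucc k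
      _ = 4 * (2 * (1/4:ℝ))^k := by rw [mul_pow]; ring
      _ = _ := by norm_num
  have hsum1 : Summable (fun k => ‖d k‖) := by
    refine Summable.of_nonneg_of_le (fun k => by positivity) (fun k => ?_) hsum2
    have : (1:ℝ) ≤ 2^k := one_le_pow₀ (by norm_num)
    nlinarith [norm_nonneg (d k)]
  have hpart : ∀ n, ∑ k ∈ Finset.range (n+1), d k = p n := by
    intro n
    induction n with
    | zero => simp [hd0]
    | succ n ih => rw [Finset.sum_range_succ, ih, hds]; abel
  refine ⟨d, hmem, ?_, hsum2⟩
  rw [hsum1.of_norm.hasSum_iff_tendsto_nat, ← tendsto_add_atTop_iff_nat 1]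
  simp only [hpart]
  rw [tendsto_iff_dist_tendsto_zero]
  refine squeeze_zero (fun _ => dist_nonneg) (fun k => ?_)
    (tendsto_pow_atTop_nhds_zero_of_lt_one (r := (1/4:ℝ)) (by norm_num) (by norm_num))
  rw [dist_comm]
  exact (hd k).le

lemma test_smul (w : ball (0:ℂ) 1) (a : ℂ) (d : L2) (O : L2) :
    inner ℂ O (test w (a • d)) = a * inner ℂ O (test w d) := by
  rw [← inner_smul_right]
  congr 1
  refine Lp.ext ?_
  filter_upwards [mulL_coe (memConj (psiMem w)) (a • d), mulL_coe (memConj (psiMem w)) d,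
    Lp.coeFn_smul a d, Lp.coeFn_smul a (test w d)] with θ h1 h2 h3 h4
  rw [h4, Pi.smul_apply, test, test, h1, h2, h3, Pi.smul_apply, smul_eq_mul, smul_eq_mul]
  ring

lemma get_O (d : ℕ → L2) (hd : Summable (fun k => 2^k * ‖d k‖)) (N : ℝ) (hN : 0 < N) :
    ∃ O : L2, Good (1/N) O ∧ ∃ C : ℝ, ∀ k w, ‖inner ℂ O (test w (d k))‖ ≤ C * (1/2:ℝ)^k := by
  let y : ℕ × Fin 4 → L2 := fun p => (Complex.I^(p.2:ℕ) * 2^p.1) • d p.1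
  have hy : ∀ p, ‖y p‖ = 2^p.1 * ‖d p.1‖ * (1:ℝ) := by
    intro p
    simp [y, norm_smul]
  have hs : Summable (fun p => ‖y p‖) := by
    simp only [hy]
    exact Summable.mul_of_nonneg hd (g := fun _ : Fin 4 => (1:ℝ)) (hasSum_fintype _).summable
      (fun _ => by positivity) (fun _ => zero_le_one)
  obtain ⟨O, hO, h⟩ := key y (∑' p, ‖y p‖) (N * (∑' p, ‖y p‖) + 1) N hN
    (fun s => hs.sum_le_tsum s fun _ _ => norm_nonneg _) (by linarith)
  set C' := N * (∑' p, ‖y p‖) + 1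
  refine ⟨O, hO, 2 * C', fun k w => ?_⟩
  set z := inner ℂ O (test w (d k)) with hz
  have h0 : ∀ c : Fin 4, (Complex.I^(c:ℕ) * (2:ℂ)^k * z).re ≤ C' := by
    intro c
    have := h (k, c) w
    rwa [test_smul] at this
  have e : ((2:ℂ)^k) = ((2^k : ℝ) : ℂ) := by push_cast; rfl
  have a0 := h0 0
  have a1 := h0 1
  have a2 := h0 2
  have a3 := h0 3
  rw [e] at a0 a1 a2 a3
  have i3 : Complex.I^3 = -Complex.I := by rw [pow_succ, I_sq]; ring
  simp only [Fin.val_zero, Fin.val_one, Fin.val_two, pow_zero, pow_one, I_sq, one_mul, mul_assoc,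
    neg_mul, neg_re, re_ofReal_mul, I_mul_re, im_ofReal_mul] at a0 a1 a2
  rw [show ((3 : Fin 4) : ℕ) = 3 from rfl, i3, mul_assoc, neg_mul, neg_re, I_mul_re, im_ofReal_mul,
    neg_neg] at a3
  have hk : (0:ℝ) < 2^k := by positivity
  have b1 : |2^k * z.re| ≤ C' := abs_le.2 ⟨by linarith, by linarith⟩
  have b2 : |2^k * z.im| ≤ C' := abs_le.2 ⟨by linarith, by linarith⟩
  rw [abs_mul, abs_of_pos hk] at b1 b2
  have b3 := norm_le_abs_re_add_abs_im z
  have b4 : 2^k * ‖z‖ ≤ 2 * C' := by nlinarith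
  rw [one_div, inv_pow, ← div_eq_mul_inv, le_div_iff₀ hk]
  linarith

lemma approx (f : L2) (hf : f ∈ H2) (N : ℝ) (hN : 0 < N) :
    ∃ O : L2, ∃ hO : Good (1/N) O, ∃ f' ∈ H2, InDiscAlgebra f' ∧
      ∀ h ∈ H2, inner ℂ h f' = inner ℂ (mulL (good_mem hO) h) f := by
  obtain ⟨d, hd1, hd2, hd3⟩ := decomp f hf
  obtain ⟨O, hO, C, hC⟩ := get_O d hd3 N hN
  choose R hR RL hRL hin using fun k => poly_step (good_mem hO) (good_neg hO) (d k) (hd1 k)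
  have hb : ∀ k, ∀ w ∈ closedBall (0:ℂ) 1, ‖R k w‖ ≤ C * (1/2:ℝ)^k := by
    intro k w hw
    rw [← closure_ball (0:ℂ) one_ne_zero] at hw
    have hcl : IsClosed {w | ‖R k w‖ ≤ C * (1/2:ℝ)^k} :=
      isClosed_le (hR k).continuous.norm continuous_const
    refine closure_minimal ?_ hcl hw
    intro v hv
    have := R_eval hO (hR k) (hRL k) (hin k) ⟨v, hv⟩
    simp only at this
    show ‖R k v‖ ≤ _
    rw [this]
    exact hC k _
  have hgs : Summable (fun k : ℕ => C * (1/2:ℝ)^k) :=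
    (summable_geometric_of_lt_one (by norm_num) (by norm_num)).mul_left C
  set F : ℂ → ℂ := fun w => ∑' k, R k w with hF
  have hFc : ContinuousOn F (closedBall (0:ℂ) 1) :=
    continuousOn_tsum (fun k => (hR k).continuous.continuousOn) hgs hb
  have hFd : DifferentiableOn ℂ F (ball (0:ℂ) 1) :=
    differentiableOn_tsum_of_summable_norm hgs (fun k => (hR k).differentiableOn) isOpen_ball
      (fun k w hw => hb k w (ball_subset_closedBall hw))
  have hm : MemLp (fun θ => F (pt θ)) 2 m := (cont_mem (disc_cont hFc)).mono_exponent le_top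
  refine ⟨O, hO, hm.toLp, disc_mem hFc hFd _ hm.coeFn_toLp, ⟨F, hFc, hFd, hm.coeFn_toLp⟩, ?_⟩
  intro h hh
  have s1 : HasSum (fun k => inner ℂ (mulL (good_mem hO) h) (d k))
      (inner ℂ (mulL (good_mem hO) h) f) :=
    hd2.mapL (innerSL ℂ (mulL (good_mem hO) h))
  have s2 : HasSum (fun k => inner ℂ h (RL k)) (inner ℂ h (hm.toLp (fun θ => F (pt θ)))) := by
    simp only [inner_eq]
    refine hasSum_integral_of_dominated_convergence (fun k θ => ‖h θ‖ * (C * (1/2:ℝ)^k)) ?_ ?_ ?_ ?_ ?_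
    · intro k
      exact ((integ1 h).1.star).mul (integ1 (RL k)).1
    · intro k
      filter_upwards [hRL k] with θ hθ
      rw [norm_mul, RCLike.norm_conj, hθ]
      gcongr
      exact hb k _ (pt_mem θ)
    · exact Eventually.of_forall fun θ => hgs.mul_left _
    · simp only [tsum_mul_left]
      exact (integ1 h).norm.mul_const _
    · filter_upwards [ae_all_iff.2 hRL, hm.coeFn_toLp] with θ a c
      simp only [a, c]
      refine HasSum.mul_left _ ?_
      exact (Summable.of_norm_bounded hgs fun k => hb k _ (pt_mem θ)).hasSum
  simp only [hin _ h hh] at s2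
  exact s2.unique s1

lemma bdry {B : ℂ → ℂ} (hBan : DifferentiableOn ℂ B (ball (0:ℂ) 1))
    (hB1 : ∀ z ∈ ball (0:ℂ) 1, ‖B z‖ ≤ 1) {b : CircT → ℂ} (hbm : Measurable b)
    (hbdry : ∀ᵐ θ ∂m,
      Tendsto (fun r : ℝ => B ((r : ℂ) * pt θ)) (𝓝[<] (1:ℝ)) (𝓝 (b θ))) :
    MemLp b ⊤ m ∧ ∀ n : ℕ, ∫ θ, pt θ ^ (n+1) * b θ ∂m = 0 := by
  let r : ℕ → ℝ := fun k => 1 - 1 / ((k:ℝ) + 1)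
  have hr0 : ∀ k, 0 ≤ r k := by
    intro k
    have : 1 / ((k:ℝ)+1) ≤ 1 := by
      rw [div_le_one (by positivity)]; linarith [Nat.cast_nonneg (α := ℝ) k]
    simp only [r]; linarith
  have hr1 : ∀ k, r k < 1 := by
    intro k
    have : 0 < 1 / ((k:ℝ)+1) := by positivity
    simp only [r]; linarith
  have hrt : Tendsto r atTop (𝓝[<] (1:ℝ)) := by
    refine tendsto_nhdsWithin_iff.2 ⟨?_, Eventually.of_forall hr1⟩
    have := (tendsto_one_div_add_atTop_nhds_zero_nat (𝕜 := ℝ)).const_sub 1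
    simpa [r] using this
  have hin : ∀ k, ∀ z ∈ closedBall (0:ℂ) 1, (r k : ℂ) * z ∈ ball (0:ℂ) 1 := by
    intro k z hz
    have hz1 : ‖z‖ ≤ 1 := by simpa using hz
    rw [mem_ball_zero_iff, norm_mul, norm_real, Real.norm_of_nonneg (hr0 k)]
    nlinarith [hr0 k, hr1 k, norm_nonneg z]
  have hlim : ∀ᵐ θ ∂m, Tendsto (fun k => B ((r k : ℂ) * pt θ)) atTop (𝓝 (b θ)) := by
    filter_upwards [hbdry] with θ h
    exact h.comp hrt
  have hb1 : ∀ᵐ θ ∂m, ‖b θ‖ ≤ 1 := by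
    filter_upwards [hlim] with θ h
    exact le_of_tendsto h.norm (Eventually.of_forall fun k => hB1 _ (hin k _ (pt_mem θ)))
  refine ⟨memLp_top_of_bound hbm.aestronglyMeasurable 1 hb1, fun n => ?_⟩
  have hc : ∀ k, ContinuousOn (fun z => B ((r k : ℂ) * z)) (closedBall (0:ℂ) 1) := fun k =>
    hBan.continuousOn.comp (by fun_prop) (hin k)
  have hdd : ∀ k, DifferentiableOn ℂ (fun z => B ((r k : ℂ) * z)) (ball (0:ℂ) 1) := fun k =>
    hBan.comp (by fun_prop) (fun z hz => hin k z (ball_subset_closedBall hz))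
  have ht := tendsto_integral_of_dominated_convergence (μ := m)
    (F := fun k θ => pt θ ^ (n+1) * B ((r k : ℂ) * pt θ)) (f := fun θ => pt θ ^ (n+1) * b θ)
    (fun _ => (1:ℝ))
    (fun k => ((pt_cont.pow (n+1)).mul (disc_cont (hc k))).aestronglyMeasurable)
    (integrable_const _)
    (fun k => Eventually.of_forall fun θ => by
      rw [norm_mul, norm_pow, pt_norm, one_pow, one_mul]
      exact hB1 _ (hin k _ (pt_mem θ)))
    (by
      filter_upwards [hlim] with θ h
      exact h.const_mul _)
  have hz : ∀ k, ∫ θ, pt θ ^ (n+1) * B ((r k : ℂ) * pt θ) ∂m = 0 := fun k =>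
    disc_neg (hc k) (hdd k) n
  simp only [hz] at ht
  exact (tendsto_nhds_unique ht tendsto_const_nhds)

/-- **Pairs in `K^⊥` with first coordinate in the disc algebra are dense in
`K^⊥`.** -/
theorem discAlgebra_pairs_dense_in_Kperp
    -- `b` as an analytic function `B` on the unit disc, bounded by `1`:
    (B : ℂ → ℂ) (hBan : DifferentiableOn ℂ B (ball (0:ℂ) 1))
    (hB1 : ∀ z ∈ ball (0:ℂ) 1, ‖B z‖ ≤ 1)
    -- its boundary function `b` on the circle (radial limits a.e.):
    (b : CircT → ℂ) (hbm : Measurable b)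
    (hbdry : ∀ᵐ θ ∂m,
      Tendsto (fun r : ℝ => B ((r : ℂ) * pt θ)) (𝓝[<] (1:ℝ)) (𝓝 (b θ)))
    -- `b` is an extreme point of the unit ball: `∫ log(1-|b|) dm = -∞`:
    (hext : ∫⁻ θ, negLogNN (1 - ‖b θ‖) ∂m = ⊤)
    -- an element `(f, g)` of `K^⊥` and `ε > 0`:
    (f g : L2) (hfg : MemKperp b f g) (ε : ℝ) (hε : 0 < ε) :
    ∃ f' g' : L2, MemKperp b f' g' ∧ InDiscAlgebra f' ∧
      Real.sqrt (‖f - f'‖^2 + ‖g - g'‖^2) < ε := by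
  obtain ⟨hbM, hbH⟩ := bdry hBan hB1 hbm hbdry
  obtain ⟨hf, hgE, hort⟩ := hfg
  obtain ⟨δ1, hδ1, c1⟩ := close f (ε/2) (by linarith)
  obtain ⟨δ2, hδ2, c2⟩ := close g (ε/2) (by linarith)
  set δ := min δ1 δ2 with hδ
  have hδpos : 0 < δ := lt_min hδ1 hδ2
  obtain ⟨O, hO, f', hf', hA, hin⟩ := approx f hf (1/δ) (by positivity)
  have hd : 1 / (1/δ) = δ := one_div_one_div δ
  have d1 := c1 _ (by rw [hd]; exact min_le_left _ _) O hO
  have d2 := c2 _ (by rw [hd]; exact min_le_right _ _) O hO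
  refine ⟨f', mulL (memConj (good_mem hO)) g, ⟨hf', ?_, ?_⟩, hA, ?_⟩
  · filter_upwards [hgE, mulL_coe (memConj (good_mem hO)) g] with θ h1 h2 h3
    rw [h2, h1 h3, mul_zero]
  · intro h hh
    have k := hort (mulL (good_mem hO) h) (mulL_mem (good_mem hO) (good_neg hO) h hh)
    have e1 : ∫ θ, (starRingEnd ℂ) (b θ * h θ) * f' θ ∂m
        = ∫ θ, (starRingEnd ℂ) (b θ * mulL (good_mem hO) h θ) * f θ ∂m := by
      have q := hin (mulL hbM h) (mulL_mem hbM hbH h hh)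
      rw [inner_eq, inner_eq] at q
      trans ∫ θ, (starRingEnd ℂ) (mulL hbM h θ) * f' θ ∂m
      · refine integral_congr_ae ?_
        filter_upwards [mulL_coe hbM h] with θ h1
        rw [h1]
      · rw [q]
        refine integral_congr_ae ?_
        filter_upwards [mulL_coe hbM h, mulL_coe (good_mem hO) h,
          mulL_coe (good_mem hO) (mulL hbM h)] with θ h1 h2 h3
        rw [h3, h1, h2]
        ring_nf
    have e2 : ∫ θ, (starRingEnd ℂ) ((Real.sqrt (1 - ‖b θ‖^2) : ℂ) * h θ)
          * mulL (memConj (good_mem hO)) g θ ∂m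
        = ∫ θ, (starRingEnd ℂ) ((Real.sqrt (1 - ‖b θ‖^2) : ℂ) * mulL (good_mem hO) h θ)
          * g θ ∂m := by
      refine integral_congr_ae ?_
      filter_upwards [mulL_coe (memConj (good_mem hO)) g, mulL_coe (good_mem hO) h] with θ h1 h2
      rw [h1, h2]
      simp only [map_mul]
      ring
    rw [e1, e2]
    exact k
  · have hff : ‖f - f'‖ ≤ ‖f - mulL (memConj (good_mem hO)) f‖ := by
      have q := hin (f - f') (Submodule.sub_mem _ hf hf')
      rw [mulL_adj] at q
      have q2 : inner ℂ (f - f') (f - f')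
          = inner ℂ (f - f') (f - mulL (memConj (good_mem hO)) f) := by
        rw [inner_sub_right (f - f') f f', inner_sub_right (f - f') f, q]
      have q3 : ‖f - f'‖ * ‖f - f'‖ ≤ ‖f - f'‖ * ‖f - mulL (memConj (good_mem hO)) f‖ := by
        rw [← inner_self_eq_norm_mul_norm (𝕜 := ℂ), q2]
        exact re_inner_le_norm _ _
      by_contra! hc
      have : 0 < ‖f - f'‖ := (norm_nonneg _).trans_lt hc
      nlinarith
    rw [Real.sqrt_lt' hε]
    have n1 := norm_nonneg (f - f')
    have n2 := norm_nonneg (g - mulL (memConj (good_mem hO)) g)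
    nlinarith
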